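/- Let H be a Hopf algebra over a field k with bijective antipode. The following are equivalent: (1) Gpd_H(εk) < ∞; (2) there exists a monomorphism of left H-modules ι : εk → Λ with pd_H(Λ) < ∞; (3) Gpd_H(M) < ∞ for every left H-module M. Moreover, the left Gorenstein global dimension of H equals Gpd_H(εk), and if either of Gpd_H(εk) and pd_H(Λ) is finite then Gpd_H(εk) = pd_H(Λ). -/

import Mathlib

open TensorProduct

universe u

noncomputable section GorensteinCore

/-- `ProjDimLE R n M` : the left `R`-module `M` has a projective resolution of length `≤ n`. -/
def ProjDimLE (R : Type u) [Ring R] : ℕ → (M : Type u) → [AddCommGroup M] → [Module R M] → Prop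
  | 0, M, _, _ => Module.Projective R M
  | (n+1), M, _, _ => Module.Projective R M ∨
      ∃ (P : ModuleCat.{u} R) (f : P →ₗ[R] M), Module.Projective R P ∧
      Function.Surjective f ∧ ProjDimLE R n (LinearMap.ker f)

/-- The projective dimension of a module, as an element of `ℕ∞` (`⊤` = infinite). -/
def projDim (R : Type u) [Ring R] (M : Type u) [AddCommGroup M] [Module R M] : ℕ∞ :=
  sInf {n : ℕ∞ | ∃ m : ℕ, n = (m : ℕ∞) ∧ ProjDimLE R m M}

/-- A module is Gorenstein projective if it is a syzygy of a totally acyclic complex of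
projective modules. -/
def IsGorensteinProjective (R : Type u) [Ring R] (M : Type u) [AddCommGroup M] [Module R M] :
    Prop :=
  ∃ (P : ℤ → ModuleCat.{u} R) (d : ∀ i : ℤ, P (i+1) →ₗ[R] P i),
    (∀ i, Module.Projective R (P i)) ∧
    (∀ i, LinearMap.range (d (i+1)) = LinearMap.ker (d i)) ∧
    (∀ (Q : ModuleCat.{u} R), Module.Projective R Q →
      ∀ (i : ℤ) (f : P (i+1) →ₗ[R] Q), f.comp (d (i+1)) = 0 →
        ∃ g : P i →ₗ[R] Q, g.comp (d i) = f) ∧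
    Nonempty (M ≃ₗ[R] LinearMap.ker (d 0))

/-- `GProjDimLE R n M` : `M` has a Gorenstein projective resolution of length `≤ n`. -/
def GProjDimLE (R : Type u) [Ring R] : ℕ → (M : Type u) → [AddCommGroup M] → [Module R M] → Prop
  | 0, M, _, _ => IsGorensteinProjective R M
  | (n+1), M, _, _ => IsGorensteinProjective R M ∨
      ∃ (G : ModuleCat.{u} R) (f : G →ₗ[R] M), IsGorensteinProjective R G ∧
      Function.Surjective f ∧ GProjDimLE R n (LinearMap.ker f)

/-- The Gorenstein projective dimension of a module, as an element of `ℕ∞`. -/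
def gProjDim (R : Type u) [Ring R] (M : Type u) [AddCommGroup M] [Module R M] : ℕ∞ :=
  sInf {n : ℕ∞ | ∃ m : ℕ, n = (m : ℕ∞) ∧ GProjDimLE R m M}

/-- The (left) Gorenstein global dimension of a ring `R`. -/
def lGgldim (R : Type u) [Ring R] : ℕ∞ :=
  ⨆ M : ModuleCat.{u} R, gProjDim R M

/-- The (left) global dimension of a ring `R`. -/
def lgldim (R : Type u) [Ring R] : ℕ∞ :=
  ⨆ M : ModuleCat.{u} R, projDim R M

/-- `InjDimLE R n M` : the left `R`-module `M` has an injective resolution of length `≤ n`. -/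
def InjDimLE (R : Type u) [Ring R] : ℕ → (M : Type u) → [AddCommGroup M] → [Module R M] → Prop
  | 0, M, _, _ => Module.Injective R M
  | (n+1), M, _, _ => Module.Injective R M ∨
      ∃ (I : ModuleCat.{u} R) (f : M →ₗ[R] I), Module.Injective R I ∧
      Function.Injective f ∧ InjDimLE R n (I ⧸ LinearMap.range f)

/-- The injective dimension of a module, as an element of `ℕ∞`. -/
def injDim (R : Type u) [Ring R] (M : Type u) [AddCommGroup M] [Module R M] : ℕ∞ :=
  sInf {n : ℕ∞ | ∃ m : ℕ, n = (m : ℕ∞) ∧ InjDimLE R m M}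

/-- `silp R` : the supremum of the injective dimensions of projective left `R`-modules. -/
def silp (R : Type u) [Ring R] : ℕ∞ :=
  ⨆ (M : ModuleCat.{u} R) (_ : Module.Projective R M), injDim R M

/-- `spli R` : the supremum of the projective dimensions of injective left `R`-modules. -/
def spli (R : Type u) [Ring R] : ℕ∞ :=
  ⨆ (M : ModuleCat.{u} R) (_ : Module.Injective R M), projDim R M

end GorensteinCore
noncomputable section HopfCore

variable (k : Type u) [CommRing k] (H : Type u) [Ring H] [HopfAlgebra k H]

/-- The trivial left `H`-module structure on `k`, given by the counit. -/
def trivModule : Module H k :=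
  Module.compHom k ((Bialgebra.counitAlgHom k H : H →ₐ[k] k) : H →+* k)

/-- The trivial left `H`-module `εk`, as an object of `ModuleCat H`. -/
def trivMod : ModuleCat.{u} H :=
  @ModuleCat.of H _ k _ (trivModule k H)

/-- The counit of `H`, as a ring homomorphism out of `Hᵐᵒᵖ`. -/
def counitOp : Hᵐᵒᵖ →+* k :=
  RingHom.fromOpposite ((Bialgebra.counitAlgHom k H : H →ₐ[k] k) : H →+* k)
    (fun _ _ => mul_comm _ _)

/-- The trivial right `H`-module structure on `k` (as a left `Hᵐᵒᵖ`-module). -/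
def trivModuleOp : Module Hᵐᵒᵖ k :=
  Module.compHom k (counitOp k H)

/-- The trivial right `H`-module `k_ε`, as an object of `ModuleCat Hᵐᵒᵖ`. -/
def trivModOp : ModuleCat.{u} Hᵐᵒᵖ :=
  @ModuleCat.of Hᵐᵒᵖ _ k _ (trivModuleOp k H)

section TensorAction

variable (M N : Type u) [AddCommGroup M] [Module k M] [Module H M]
  [IsScalarTower k H M] [SMulCommClass k H M]
  [AddCommGroup N] [Module k N] [Module H N] [IsScalarTower k H N] [SMulCommClass k H N]

/-- The representation of `H` on a left `H`-module `M`, as an algebra morphism to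
`End_k(M)`. -/
def hRep : H →ₐ[k] Module.End k M :=
  (Algebra.lsmul k k M : H →ₐ[k] Module.End k M)

/-- The representation of `H` on `M ⊗[k] N` given by the comultiplication of `H`:
`h • (m ⊗ n) = ∑ h₁ • m ⊗ h₂ • n`. -/
def tensorRep : H →ₐ[k] Module.End k (M ⊗[k] N) :=
  ((Module.endTensorEndAlgHom (R := k) (S := k) (A := k) (M := M) (N := N)).comp
    (Algebra.TensorProduct.map (hRep k H M) (hRep k H N))).comp
    (Bialgebra.comulAlgHom k H)

/-- The diagonal left `H`-module structure on `M ⊗[k] N`: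
`h • (m ⊗ n) = ∑ h₁ • m ⊗ h₂ • n`. -/
def tensorModule : Module H (M ⊗[k] N) :=
  Module.compHom (M ⊗[k] N)
    ((tensorRep k H M N).toRingHom : H →+* Module.End k (M ⊗[k] N))

/-- The tensor product `M ⊗[k] N` with its diagonal left `H`-module structure, as an
object of `ModuleCat H`. -/
def tensorMod : ModuleCat.{u} H :=
  @ModuleCat.of H _ (M ⊗[k] N) _ (tensorModule k H M N)

end TensorAction

end HopfCore

section Modules

variable {R : Type u} [Ring R]

/-- The sequence `0 → A → B → C → 0` given by `f` and `g` is exact. -/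
structure IsShortExact {A B C : ModuleCat.{u} R} (f : A →ₗ[R] B) (g : B →ₗ[R] C) : Prop where
  injective : Function.Injective f
  exact : Function.Exact f g
  surjective : Function.Surjective g

namespace IsShortExact

variable {A B C : ModuleCat.{u} R} {f : A →ₗ[R] B} {g : B →ₗ[R] C}

lemma apply_apply (h : IsShortExact f g) (a : A) : g (f a) = 0 := h.exact.apply_apply_eq_zero a

lemma exists_eq (h : IsShortExact f g) {b : B} (hb : g b = 0) : ∃ a, f a = b := (h.exact b).1 hb

lemma ofKer (g : B →ₗ[R] C) (hg : Function.Surjective g) :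
    IsShortExact (A := ModuleCat.of R (LinearMap.ker g)) (LinearMap.ker g).subtype g :=
  ⟨Subtype.val_injective, LinearMap.exact_subtype_ker_map g, hg⟩

lemma ofRange (f : A →ₗ[R] B) (hf : Function.Injective f) :
    IsShortExact (C := ModuleCat.of R (B ⧸ LinearMap.range f)) f (LinearMap.range f).mkQ :=
  ⟨hf, LinearMap.exact_map_mkQ_range f, Submodule.mkQ_surjective _⟩

/-- The first term of a short exact sequence is the kernel of the second map. -/
lemma equivKer (h : IsShortExact f g) : Nonempty (A ≃ₗ[R] LinearMap.ker g) :=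
  ⟨(LinearEquiv.ofInjective f h.injective).trans
    (LinearEquiv.ofEq _ _ (LinearMap.exact_iff.1 h.exact).symm)⟩

end IsShortExact

/-- A linear map vanishing on the kernel of a surjection factors through it. -/
lemma exists_factor_of_surjective {A B C : Type*} [AddCommGroup A] [AddCommGroup B]
    [AddCommGroup C] [Module R A] [Module R B] [Module R C] (g : A →ₗ[R] B)
    (hg : Function.Surjective g) (f : A →ₗ[R] C) (h : ∀ a, g a = 0 → f a = 0) :
    ∃ f' : B →ₗ[R] C, ∀ a, f' (g a) = f a := by
  refine ⟨((LinearMap.ker g).liftQ f fun a ha => h a ha) ∘ₗ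
    (g.quotKerEquivOfSurjective hg).symm.toLinearMap, fun a => ?_⟩
  have : (g.quotKerEquivOfSurjective hg).symm (g a) = Submodule.Quotient.mk a := by
    rw [LinearEquiv.symm_apply_eq]; rfl
  rw [LinearMap.comp_apply, LinearEquiv.coe_coe, this]
  rfl

/-- Every module is a quotient of a projective module. -/
lemma exists_projective_cover (M : ModuleCat.{u} R) :
    ∃ (P : ModuleCat.{u} R) (p : P →ₗ[R] M), Module.Projective R P ∧ Function.Surjective p :=
  ⟨ModuleCat.of R (M →₀ R), Finsupp.linearCombination R id,
    inferInstanceAs (Module.Projective R (M →₀ R)), Finsupp.linearCombination_id_surjective R M⟩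

/-- The first extension group of `X` by any projective module vanishes. -/
def ExtOneProjVanish (X : ModuleCat.{u} R) : Prop :=
  ∀ (Q A Y : ModuleCat.{u} R), Module.Projective R Q → ∀ (i : A →ₗ[R] Y) (p : Y →ₗ[R] X),
    IsShortExact i p → ∀ f : A →ₗ[R] Q, ∃ g : Y →ₗ[R] Q, ∀ a, g (i a) = f a

/-- `M` embeds in a module satisfying `P` such that the cokernel satisfies `C`. -/
def EmbedsWith (P C : ModuleCat.{u} R → Prop) (M : ModuleCat.{u} R) : Prop :=
  ∃ (Y Z : ModuleCat.{u} R) (i : M →ₗ[R] Y) (p : Y →ₗ[R] Z), IsShortExact i p ∧ P Y ∧ C Z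

/-- `Z` is a quotient of a projective module such that the kernel satisfies `C`. -/
def SyzygyWith (C : ModuleCat.{u} R → Prop) (Z : ModuleCat.{u} R) : Prop :=
  ∃ (M Y : ModuleCat.{u} R) (i : M →ₗ[R] Y) (p : Y →ₗ[R] Z),
    IsShortExact i p ∧ Module.Projective R Y ∧ C M

lemma ExtOneProjVanish.of_ses {A X B : ModuleCat.{u} R} {i : A →ₗ[R] X} {p : X →ₗ[R] B}
    (h : IsShortExact i p) (hA : ExtOneProjVanish A) (hB : ExtOneProjVanish B) :
    ExtOneProjVanish X := by
  intro Q K Y hQ j q hjq f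
  let T : Submodule R Y := LinearMap.ker (p ∘ₗ q)
  have hT (t : T) : ∃ a, i a = q t := h.exists_eq t.2
  let q₁ : T →ₗ[R] LinearMap.range i :=
    (q ∘ₗ T.subtype).codRestrict _ fun t => hT t
  let e := LinearEquiv.ofInjective i h.injective
  let q' : T →ₗ[R] A := e.symm.toLinearMap ∘ₗ q₁
  have hq' (t : T) : i (q' t) = q t := by
    have : e (q' t) = q₁ t := by simp [q']
    exact congrArg Subtype.val this
  let j' : K →ₗ[R] T := j.codRestrict T fun x => by simp [T, hjq.apply_apply]
  have h₁ : IsShortExact (A := K) (B := ModuleCat.of R T) (C := A) j' q' := by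
    refine ⟨fun x y hxy => hjq.injective (congrArg Subtype.val hxy), fun t => ?_, fun a => ?_⟩
    · constructor
      · intro ht
        obtain ⟨x, hx⟩ := hjq.exists_eq (b := (t : T).1) (by rw [← hq', ht, map_zero])
        exact ⟨x, Subtype.ext hx⟩
      · rintro ⟨x, rfl⟩
        apply h.injective
        rw [hq', map_zero]
        exact hjq.apply_apply x
    · obtain ⟨y, hy⟩ := hjq.surjective (i a)
      refine ⟨⟨y, by simp [T, hy, h.apply_apply]⟩, h.injective ?_⟩
      exact (hq' _).trans hy
  obtain ⟨g₁, hg₁⟩ := hA Q K (ModuleCat.of R T) hQ j' q' h₁ f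
  obtain ⟨g, hg⟩ := hB Q (ModuleCat.of R T) Y hQ T.subtype (p ∘ₗ q)
    (IsShortExact.ofKer _ (h.surjective.comp hjq.surjective)) g₁
  exact ⟨g, fun a => (hg (j' a)).trans (hg₁ a)⟩

/-- Horseshoe embedding: embeddings of the outer terms of a short exact sequence, together with
an extension of the first one to the middle term, combine to an embedding of the middle term. -/
lemma exists_horseshoe_embedding {A X B P A' Q B' : ModuleCat.{u} R}
    {i : A →ₗ[R] X} {p : X →ₗ[R] B} (h : IsShortExact i p)
    {iA : A →ₗ[R] P} {pA : P →ₗ[R] A'} (hA : IsShortExact iA pA)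
    {iB : B →ₗ[R] Q} {pB : Q →ₗ[R] B'} (hB : IsShortExact iB pB)
    (a : X →ₗ[R] P) (ha : ∀ x, a (i x) = iA x) :
    ∃ (X' : ModuleCat.{u} R) (j : X →ₗ[R] ModuleCat.of R (P × Q))
      (q : ModuleCat.of R (P × Q) →ₗ[R] X') (s : A' →ₗ[R] X') (t : X' →ₗ[R] B'),
      IsShortExact j q ∧ IsShortExact s t := by
  let j : X →ₗ[R] P × Q := a.prod (iB ∘ₗ p)
  have hj : Function.Injective j := by
    rw [← LinearMap.ker_eq_bot, LinearMap.ker_eq_bot']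
    intro x hx
    have h1 : a x = 0 := congrArg Prod.fst hx
    have h2 : iB (p x) = 0 := congrArg Prod.snd hx
    obtain ⟨y, rfl⟩ := h.exists_eq (hB.injective (h2.trans (map_zero iB).symm))
    rw [ha] at h1
    rw [hA.injective (h1.trans (map_zero iA).symm), map_zero]
  have hses := IsShortExact.ofRange (A := X) (B := ModuleCat.of R (P × Q)) j hj
  set q : P × Q →ₗ[R] (P × Q) ⧸ LinearMap.range j := (LinearMap.range j).mkQ with hq
  have hqj (x : X) : q (a x, iB (p x)) = 0 := hses.apply_apply x
  obtain ⟨s, hs⟩ := exists_factor_of_surjective pA hA.surjective (q ∘ₗ LinearMap.inl R P Q)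
    (fun x hx => by
      obtain ⟨y, rfl⟩ := hA.exists_eq hx
      have := hqj (i y)
      rw [h.apply_apply, ha, map_zero] at this
      exact this)
  obtain ⟨t, ht⟩ := exists_factor_of_surjective q hses.surjective (pB ∘ₗ LinearMap.snd R P Q)
    (fun x hx => by
      obtain ⟨y, rfl⟩ := hses.exists_eq hx
      exact hB.apply_apply (p y))
  refine ⟨ModuleCat.of R ((P × Q) ⧸ LinearMap.range j), j, q, s, t, hses, ?_,
    fun x => ?_, fun z => ?_⟩
  · rw [← LinearMap.ker_eq_bot, LinearMap.ker_eq_bot']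
    intro z hz
    obtain ⟨y, rfl⟩ := hA.surjective z
    rw [hs] at hz
    obtain ⟨x, hx⟩ := hses.exists_eq hz
    have h1 : a x = y := congrArg Prod.fst hx
    have h2 : iB (p x) = 0 := congrArg Prod.snd hx
    obtain ⟨w, rfl⟩ := h.exists_eq (hB.injective (h2.trans (map_zero iB).symm))
    rw [← h1, ha, hA.apply_apply]
  · constructor
    · intro hx
      obtain ⟨⟨y, z⟩, rfl⟩ := hses.surjective x
      change t (q (y, z)) = 0 at hx
      rw [ht] at hx
      obtain ⟨b, hb⟩ := hB.exists_eq (b := z) hx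
      obtain ⟨w, rfl⟩ := h.surjective b
      refine ⟨pA (y - a w), ?_⟩
      rw [hs]
      have : ((y - a w, 0) : P × Q) = (y, z) - (a w, iB (p w)) := by simp [hb]
      change q (y - a w, 0) = q (y, z)
      rw [this, map_sub, hqj, sub_zero]
    · rintro ⟨y, rfl⟩
      obtain ⟨w, rfl⟩ := hA.surjective y
      rw [hs]
      change t (q (w, 0)) = 0
      rw [ht]
      simp
  · obtain ⟨w, rfl⟩ := hB.surjective z
    exact ⟨q (0, w), by rw [ht]; simp⟩

/-- The cokernel of a composite of monomorphisms is an extension of the cokernels. -/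
lemma exists_comp_ses {K G M P G₀ : ModuleCat.{u} R}
    {i : K →ₗ[R] G} {p : G →ₗ[R] M} (h : IsShortExact i p)
    {j : G →ₗ[R] P} {q : P →ₗ[R] G₀} (h' : IsShortExact j q) :
    ∃ (C : ModuleCat.{u} R) (r : P →ₗ[R] C) (s : M →ₗ[R] C) (t : C →ₗ[R] G₀),
      IsShortExact (j ∘ₗ i) r ∧ IsShortExact s t := by
  have hses := IsShortExact.ofRange (j ∘ₗ i) (h'.injective.comp h.injective)
  set r : P →ₗ[R] P ⧸ LinearMap.range (j ∘ₗ i) := (LinearMap.range (j ∘ₗ i)).mkQ with hr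
  obtain ⟨s, hs⟩ := exists_factor_of_surjective p h.surjective (r ∘ₗ j) (fun x hx => by
    obtain ⟨y, rfl⟩ := h.exists_eq hx
    exact hses.apply_apply y)
  obtain ⟨t, ht⟩ := exists_factor_of_surjective r hses.surjective q (fun x hx => by
    obtain ⟨y, rfl⟩ := hses.exists_eq hx
    exact h'.apply_apply (i y))
  refine ⟨ModuleCat.of R (P ⧸ LinearMap.range (j ∘ₗ i)), r, s, t, hses, ?_,
    fun x => ?_, fun z => ?_⟩
  · rw [← LinearMap.ker_eq_bot, LinearMap.ker_eq_bot']
    intro z hz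
    obtain ⟨y, rfl⟩ := h.surjective z
    rw [hs] at hz
    obtain ⟨x, hx⟩ := hses.exists_eq hz
    rw [← h'.injective hx, h.apply_apply]
  · constructor
    · intro hx
      obtain ⟨y, rfl⟩ := hses.surjective x
      rw [ht] at hx
      obtain ⟨b, rfl⟩ := h'.exists_eq hx
      exact ⟨p b, hs b⟩
    · rintro ⟨y, rfl⟩
      obtain ⟨w, rfl⟩ := h.surjective y
      rw [hs]
      exact (ht (j w)).trans (h'.apply_apply w)
  · obtain ⟨w, rfl⟩ := h'.surjective z
    exact ⟨r w, ht w⟩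

/-- A class of modules whose members `X` satisfy `Ext¹(X, Q) = 0` for `Q` projective and embed in
projective modules with cokernel in the class. -/
def IsCosyzygyClass (C : ModuleCat.{u} R → Prop) : Prop :=
  ∀ X, C X → ExtOneProjVanish X ∧ EmbedsWith (fun P => Module.Projective R P) C X

/-- `X` belongs to a class stable under cosyzygies. -/
def HasCosyzygies (X : ModuleCat.{u} R) : Prop :=
  ∃ C : ModuleCat.{u} R → Prop, IsCosyzygyClass C ∧ C X

lemma isCosyzygyClass_hasCosyzygies : IsCosyzygyClass (R := R) HasCosyzygies := by
  rintro X ⟨C, hC, hX⟩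
  obtain ⟨h1, P, Z, i, p, h, hP, hZ⟩ := hC X hX
  exact ⟨h1, P, Z, i, p, h, hP, C, hC, hZ⟩

lemma HasCosyzygies.of_ses {A X B : ModuleCat.{u} R} {i : A →ₗ[R] X} {p : X →ₗ[R] B}
    (h : IsShortExact i p) (hA : HasCosyzygies A) (hB : HasCosyzygies B) : HasCosyzygies X := by
  refine ⟨fun X => ∃ (A B : ModuleCat.{u} R) (i : A →ₗ[R] X) (p : X →ₗ[R] B),
    IsShortExact i p ∧ HasCosyzygies A ∧ HasCosyzygies B, ?_, A, B, i, p, h, hA, hB⟩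
  rintro X ⟨A, B, i, p, h, hA, hB⟩
  obtain ⟨eA, P, A', iA, pA, sA, hP, hA'⟩ := isCosyzygyClass_hasCosyzygies A hA
  obtain ⟨eB, Q, B', iB, pB, sB, hQ, hB'⟩ := isCosyzygyClass_hasCosyzygies B hB
  obtain ⟨a, ha⟩ := eB P A X hP i p h iA
  obtain ⟨X', j, q, s, t, h1, h2⟩ := exists_horseshoe_embedding h sA sB a ha
  exact ⟨eA.of_ses h eB, _, X', j, q, h1, inferInstanceAs (Module.Projective R (P × Q)),
    A', B', s, t, h2, hA', hB'⟩

lemma HasCosyzygies.of_isGorensteinProjective {M : ModuleCat.{u} R}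
    (hM : IsGorensteinProjective R M) : HasCosyzygies M := by
  obtain ⟨P, d, hP, hd, hQ, ⟨e⟩⟩ := hM
  have hdd (i : ℤ) (x : P (i + 1 + 1)) : d i (d (i + 1) x) = 0 := by
    have : d (i + 1) x ∈ LinearMap.ker (d i) := hd i ▸ LinearMap.mem_range_self _ x
    exact this
  have hex (i : ℤ) (x : P (i + 1)) (hx : d i x = 0) : ∃ y, d (i + 1) y = x := by
    have : x ∈ LinearMap.range (d (i + 1)) := hd i ▸ hx
    exact this
  -- The syzygies of the complex, presented as short exact sequences.
  have hses (i : ℤ) (X : ModuleCat.{u} R) (e : X ≃ₗ[R] LinearMap.ker (d i)) :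
      ∃ p : P (i + 1 + 1) →ₗ[R] X,
        IsShortExact (A := ModuleCat.of R (LinearMap.ker (d (i + 1))))
          (LinearMap.ker (d (i + 1))).subtype p := by
    refine ⟨e.symm.toLinearMap ∘ₗ (d (i + 1)).codRestrict (LinearMap.ker (d i)) (hdd i),
      Subtype.val_injective, fun x => ?_, e.symm.surjective.comp fun x => ?_⟩
    · constructor
      · intro hx
        have : (d (i + 1)).codRestrict (LinearMap.ker (d i)) (hdd i) x = 0 :=
          e.symm.injective (hx.trans (map_zero _).symm)
        exact ⟨⟨x, congrArg Subtype.val this⟩, rfl⟩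
      · rintro ⟨⟨x, hx⟩, rfl⟩
        have : (d (i + 1)).codRestrict (LinearMap.ker (d i)) (hdd i) x = 0 := Subtype.ext hx
        exact (congrArg e.symm this).trans (map_zero _)
    · obtain ⟨y, hy⟩ := hex i x x.2
      exact ⟨y, Subtype.ext hy⟩
  refine ⟨fun X => ∃ j : ℤ, Nonempty (X ≃ₗ[R] LinearMap.ker (d j)), ?_, 0, ⟨e⟩⟩
  rintro X ⟨j, ⟨e⟩⟩
  constructor
  · intro Q A Y hQp i p h f
    obtain ⟨q, hq⟩ := hses j X e
    have := hP (j + 1 + 1)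
    obtain ⟨s, hs⟩ := Module.projective_lifting_property p q h.surjective
    have hs' (x) : p (s x) = q x := LinearMap.congr_fun hs x
    -- `s` maps the next syzygy to `A`.
    obtain ⟨g, hg⟩ : ∃ g : P (j + 1 + 1) →ₗ[R] Q, ∀ x a, q x = 0 → i a = s x → g x = f a := by
      obtain ⟨t, ht⟩ : ∃ t : P (j + 1 + 1 + 1) →ₗ[R] A, ∀ x, i (t x) = s (d (j + 1 + 1) x) := by
        let ee := LinearEquiv.ofInjective i h.injective
        let s' : P (j + 1 + 1 + 1) →ₗ[R] LinearMap.range i :=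
          (s ∘ₗ d (j + 1 + 1)).codRestrict _ fun x => h.exists_eq (by
            rw [LinearMap.comp_apply, hs']
            exact hq.apply_apply ⟨d (j + 1 + 1) x, hdd (j + 1) x⟩)
        refine ⟨ee.symm.toLinearMap ∘ₗ s', fun x => ?_⟩
        have : ee (ee.symm (s' x)) = s' x := by simp
        exact congrArg Subtype.val this
      obtain ⟨g, hg⟩ := hQ Q hQp (j + 1 + 1) (f ∘ₗ t) (by
        ext x
        have : t (d (j + 1 + 1 + 1) x) = 0 := h.injective (by rw [ht, hdd, map_zero, map_zero])
        simp [this])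
      refine ⟨g, fun x a hx ha => ?_⟩
      obtain ⟨⟨x, hx'⟩, rfl⟩ := hq.exists_eq hx
      obtain ⟨y, rfl⟩ := hex (j + 1) x hx'
      have : t y = a := h.injective (by rw [ht, ha]; rfl)
      exact (LinearMap.congr_fun hg y).trans (congrArg f this)
    obtain ⟨F, hF⟩ := exists_factor_of_surjective (i.coprod s) (fun y => by
      obtain ⟨x, hx⟩ := hq.surjective (p y)
      obtain ⟨a, ha⟩ := h.exists_eq (b := y - s x) (by rw [map_sub, hs', hx, sub_self])
      exact ⟨(a, x), by simp [ha]⟩) (f.coprod g) (by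
      rintro ⟨a, x⟩ hx
      simp only [LinearMap.coprod_apply] at hx ⊢
      have hsx : i (-a) = s x := by
        rw [map_neg]; exact neg_eq_of_add_eq_zero_right hx
      rw [hg x (-a) (by rw [← hs', ← hsx, h.apply_apply]) hsx, map_neg, add_neg_cancel])
    exact ⟨F, fun a => by simpa using hF (a, 0)⟩
  · obtain ⟨j, rfl⟩ : ∃ i, j = i + 1 := ⟨j - 1, by ring⟩
    obtain ⟨p, hp⟩ := hses j (ModuleCat.of R (LinearMap.ker (d j))) (LinearEquiv.refl R _)
    refine ⟨_, _, (LinearMap.ker (d (j + 1))).subtype ∘ₗ e.toLinearMap, p,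
      ⟨hp.injective.comp e.injective, fun x => ?_, hp.surjective⟩, hP _, j, ⟨LinearEquiv.refl R _⟩⟩
    rw [hp.exact x]
    exact ⟨fun ⟨y, hy⟩ => ⟨e.symm y, by simpa using hy⟩, fun ⟨y, hy⟩ => ⟨e y, hy⟩⟩

lemma ProjDimLE.of_equiv {n : ℕ} {M N : Type u} [AddCommGroup M] [Module R M] [AddCommGroup N]
    [Module R N] (e : M ≃ₗ[R] N) (h : ProjDimLE R n M) : ProjDimLE R n N := by
  induction n generalizing M N with
  | zero =>
    have : Module.Projective R M := h
    exact Module.Projective.of_equiv e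
  | succ n ih =>
    obtain h | ⟨P, f, hP, hf, h⟩ := h
    · have : Module.Projective R M := h
      exact Or.inl (Module.Projective.of_equiv e)
    · exact Or.inr ⟨P, e.toLinearMap ∘ₗ f, hP, e.surjective.comp hf,
        ih (LinearEquiv.ofEq _ _ (LinearEquiv.ker_comp e f).symm) h⟩

lemma ProjDimLE.of_ses {n : ℕ} {K P M : ModuleCat.{u} R} {i : K →ₗ[R] P} {p : P →ₗ[R] M}
    (h : IsShortExact i p) (hP : Module.Projective R P) (hK : ProjDimLE R n K) :
    ProjDimLE R (n + 1) M := by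
  obtain ⟨e⟩ := h.equivKer
  exact Or.inr ⟨P, p, hP, h.surjective, hK.of_equiv e⟩

/-- A module of Gorenstein projective dimension at most `n` embeds in a module of projective
dimension at most `n`. -/
lemma embedsWith_of_gProjDimLE {n : ℕ} {M : ModuleCat.{u} R} (hM : GProjDimLE R n M) :
    EmbedsWith (fun Λ => ProjDimLE R n Λ) HasCosyzygies M := by
  induction n generalizing M with
  | zero => exact (isCosyzygyClass_hasCosyzygies M (.of_isGorensteinProjective hM)).2
  | succ n ih =>
    obtain hM | ⟨G, f, hG, hf, hK⟩ := hM
    · obtain ⟨P, Z, i, p, h, hP, hZ⟩ :=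
        (isCosyzygyClass_hasCosyzygies M (.of_isGorensteinProjective hM)).2
      exact ⟨P, Z, i, p, h, Or.inl hP, hZ⟩
    · have hses := IsShortExact.ofKer f hf
      obtain ⟨Λ, G', i, p, h, hΛ, hG'⟩ := ih (M := ModuleCat.of R (LinearMap.ker f)) hK
      obtain ⟨-, P₀, G₀, i₀, p₀, h₀, hP₀, hG₀⟩ :=
        isCosyzygyClass_hasCosyzygies G (.of_isGorensteinProjective hG)
      obtain ⟨e', P₁, G₁, i₁, p₁, h₁, hP₁, hG₁⟩ := isCosyzygyClass_hasCosyzygies G' hG'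
      obtain ⟨a, ha⟩ := e' P₀ _ Λ hP₀ i p h (i₀ ∘ₗ (LinearMap.ker f).subtype)
      obtain ⟨C, r, s, t, hC, hst⟩ := exists_comp_ses hses h₀
      obtain ⟨X, j, q, s', t', hX, hst'⟩ := exists_horseshoe_embedding h hC h₁ a ha
      obtain ⟨D, r', s'', t'', hD, hst''⟩ := exists_comp_ses hst hst'
      exact ⟨X, D, _, r', hD, .of_ses hX (inferInstanceAs (Module.Projective R (P₀ × P₁))) hΛ,
        .of_ses hst'' hG₀ hG₁⟩

/-- A relation which is total in both directions admits bi-infinite chains through any point. -/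
lemma exists_int_chain {T : Type*} (r : T → T → Prop) (h₁ : ∀ x, ∃ y, r x y) (h₂ : ∀ x, ∃ y, r y x)
    (x : T) : ∃ Z : ℤ → T, Z 1 = x ∧ ∀ i, r (Z (i + 1)) (Z i) := by
  choose a ha using h₁
  choose b hb using h₂
  let Z : ℤ → T
    | .ofNat n => b^[n] x
    | .negSucc n => a^[n + 1] x
  have hZ (i : ℤ) : r (Z (i + 1)) (Z i) := by
    match i with
    | .ofNat n =>
      change r (b^[n + 1] x) (b^[n] x)
      rw [Function.iterate_succ_apply']
      exact hb _
    | .negSucc 0 => exact ha x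
    | .negSucc (n + 1) =>
      change r (a^[n + 1] x) (a^[n + 2] x)
      rw [Function.iterate_succ_apply' a (n + 1)]
      exact ha _
  refine ⟨fun i => Z (i - 1), rfl, fun i => ?_⟩
  have := hZ (i - 1)
  rwa [show i - 1 + 1 = i + 1 - 1 by ring] at this

/-- Members of a class with vanishing `Ext¹` into projectives, stable under syzygies and
cosyzygies, are Gorenstein projective. -/
lemma isGorensteinProjective_of_class (C : ModuleCat.{u} R → Prop)
    (h₁ : ∀ X, C X → ExtOneProjVanish X)
    (h₂ : ∀ X, C X → EmbedsWith (fun P => Module.Projective R P) C X)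
    (h₃ : ∀ X, C X → SyzygyWith C X) {X : ModuleCat.{u} R} (hX : C X) :
    IsGorensteinProjective R X := by
  let T := {X : ModuleCat.{u} R // C X}
  let r (x y : T) : Prop := ∃ (P : ModuleCat.{u} R) (i : x.1 →ₗ[R] P) (p : P →ₗ[R] y.1),
    IsShortExact i p ∧ Module.Projective R P
  obtain ⟨Z, hZ1, hZ⟩ := exists_int_chain r
    (fun x => by
      obtain ⟨P, Z, i, p, h, hP, hZ⟩ := h₂ x.1 x.2
      exact ⟨⟨Z, hZ⟩, P, i, p, h, hP⟩)
    (fun x => by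
      obtain ⟨M, P, i, p, h, hP, hM⟩ := h₃ x.1 x.2
      exact ⟨⟨M, hM⟩, P, i, p, h, hP⟩) ⟨X, hX⟩
  have key (i : ℤ) : ∃ (P : ModuleCat.{u} R) (e : (Z i).1 →ₗ[R] P), Module.Projective R P ∧
      ∀ j, j + 1 = i → ∃ p : P →ₗ[R] (Z j).1, IsShortExact e p := by
    obtain ⟨j, rfl⟩ : ∃ j, i = j + 1 := ⟨i - 1, by ring⟩
    obtain ⟨P, e, p, h, hP⟩ := hZ j
    refine ⟨P, e, hP, fun j' hj' => ?_⟩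
    obtain rfl : j' = j := by lia
    exact ⟨p, h⟩
  choose P e hP hp using key
  choose p h using fun i => hp (i + 1) i rfl
  have hker (i : ℤ) : LinearMap.ker (e i ∘ₗ p i) = LinearMap.range (e (i + 1)) := by
    rw [LinearMap.ker_comp_of_ker_eq_bot _ (LinearMap.ker_eq_bot.2 ?_),
      LinearMap.exact_iff.1 (h i).exact]
    obtain ⟨j, rfl⟩ : ∃ j, i = j + 1 := ⟨i - 1, by ring⟩
    exact (h j).injective
  refine ⟨P, fun i => e i ∘ₗ p i, hP, fun i => ?_, fun Q hQ i f hf => ?_, ?_⟩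
  · rw [hker, LinearMap.range_comp_of_range_eq_top _ (LinearMap.range_eq_top.2 (h (i + 1)).surjective)]
  · obtain ⟨f', hf'⟩ := exists_factor_of_surjective (p i) (h i).surjective f (fun x hx => by
      obtain ⟨z, rfl⟩ := (h i).exists_eq hx
      obtain ⟨w, rfl⟩ := (h (i + 1)).surjective z
      exact LinearMap.congr_fun hf w)
    obtain ⟨j, rfl⟩ : ∃ j, i = j + 1 := ⟨i - 1, by ring⟩
    obtain ⟨g, hg⟩ := h₁ _ (Z j).2 Q _ _ hQ (e (j + 1)) (p j) (h j) f'
    exact ⟨g, LinearMap.ext fun x => (hg _).trans (hf' x)⟩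
  · have e1 : (X : Type u) ≃ₗ[R] (Z 1).1 := hZ1 ▸ LinearEquiv.refl R X
    exact ⟨e1.trans ((LinearEquiv.ofInjective (e 1) (h 0).injective).trans
      (LinearEquiv.ofEq _ _ (hker 0).symm))⟩

lemma extOneProjVanish_of_projective {X : ModuleCat.{u} R} (hX : Module.Projective R X) :
    ExtOneProjVanish X := by
  intro Q A Y _ i p h f
  obtain ⟨s, hs⟩ := Module.projective_lifting_property p LinearMap.id h.surjective
  have hs' (x) : p (s x) = x := LinearMap.congr_fun hs x
  obtain ⟨g, hg⟩ := exists_factor_of_surjective (i.coprod s) (fun y => by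
    obtain ⟨a, ha⟩ := h.exists_eq (b := y - s (p y)) (by simp [hs'])
    exact ⟨(a, p y), by simp [ha]⟩) (f.coprod 0) (by
    rintro ⟨a, x⟩ hx
    simp only [LinearMap.coprod_apply] at hx
    have hx0 : x = 0 := by simpa [h.apply_apply, hs'] using congrArg p hx
    subst hx0
    have : a = 0 := h.injective (by simpa using hx)
    simp [this])
  exact ⟨g, fun a => by simpa using hg (a, 0)⟩

lemma isGorensteinProjective_of_projective {X : ModuleCat.{u} R} (hX : Module.Projective R X) :
    IsGorensteinProjective R X := by
  have hz : Module.Projective R (ModuleCat.of R PUnit.{u + 1}) :=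
    inferInstanceAs (Module.Projective R PUnit.{u + 1})
  refine isGorensteinProjective_of_class (fun P => Module.Projective R P)
    (fun _ => extOneProjVanish_of_projective)
    (fun P hP => ⟨P, ModuleCat.of R PUnit.{u + 1}, LinearMap.id, 0,
      ⟨Function.injective_id, fun x => by simp, fun x => ⟨0, Subsingleton.elim _ _⟩⟩, hP, hz⟩)
    (fun P hP => ⟨ModuleCat.of R PUnit.{u + 1}, P, 0, LinearMap.id,
      ⟨fun x y _ => Subsingleton.elim (α := PUnit) x y, fun x => ?_, Function.surjective_id⟩,
      hP, hz⟩) hX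
  simp [eq_comm]

/-- `X` is an `n`-th syzygy of `M`. -/
def IsSyzygy : ℕ → ModuleCat.{u} R → ModuleCat.{u} R → Prop
  | 0, M, X => Nonempty (X ≃ₗ[R] M)
  | n + 1, M, X => SyzygyWith (fun K => IsSyzygy n K X) M

lemma exists_isSyzygy (n : ℕ) (M : ModuleCat.{u} R) : ∃ X, IsSyzygy n M X := by
  induction n generalizing M with
  | zero => exact ⟨M, ⟨LinearEquiv.refl R M⟩⟩
  | succ n ih =>
    obtain ⟨P, p, hP, hp⟩ := exists_projective_cover M
    obtain ⟨X, hX⟩ := ih (ModuleCat.of R (LinearMap.ker p))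
    exact ⟨X, _, P, _, p, IsShortExact.ofKer p hp, hP, hX⟩

lemma IsShortExact.of_equiv_right {A B C C' : ModuleCat.{u} R} {f : A →ₗ[R] B} {g : B →ₗ[R] C}
    (h : IsShortExact f g) (e : C ≃ₗ[R] C') : IsShortExact f (e.toLinearMap ∘ₗ g) :=
  ⟨h.injective, fun x => by simpa using h.exact x, e.surjective.comp h.surjective⟩

lemma IsShortExact.of_equiv_left {A A' B C : ModuleCat.{u} R} {f : A →ₗ[R] B} {g : B →ₗ[R] C}
    (h : IsShortExact f g) (e : A' ≃ₗ[R] A) : IsShortExact (f ∘ₗ e.toLinearMap) g := by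
  refine ⟨h.injective.comp e.injective, fun x => ?_, h.surjective⟩
  rw [h.exact x]
  exact ⟨fun ⟨y, hy⟩ => ⟨e.symm y, by simpa using hy⟩, fun ⟨y, hy⟩ => ⟨e y, hy⟩⟩

lemma IsSyzygy.of_equiv {n : ℕ} {M M' X : ModuleCat.{u} R} (h : IsSyzygy n M X)
    (e : M ≃ₗ[R] M') : IsSyzygy n M' X := by
  cases n with
  | zero =>
    obtain ⟨e'⟩ := h
    exact ⟨e'.trans e⟩
  | succ n =>
    obtain ⟨K, P, i, p, h, hP, hK⟩ := h
    exact ⟨K, P, i, _, h.of_equiv_right e, hP, hK⟩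

/-- Syzygies of `n`-th syzygies are `n`-th syzygies. -/
lemma IsSyzygy.exists_of_ses {n : ℕ} {M X K P : ModuleCat.{u} R} (hX : IsSyzygy n M X)
    {i : K →ₗ[R] P} {p : P →ₗ[R] X} (h : IsShortExact i p) (hP : Module.Projective R P) :
    ∃ M', IsSyzygy n M' K := by
  have : IsSyzygy (n + 1) M K := by
    induction n generalizing M with
    | zero =>
      obtain ⟨e⟩ := hX
      exact ⟨K, P, i, _, h.of_equiv_right e, hP, ⟨LinearEquiv.refl R K⟩⟩
    | succ n ih =>
      obtain ⟨L, P', i', p', h', hP', hL⟩ := hX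
      exact ⟨L, P', i', p', h', hP', ih hL⟩
  obtain ⟨L, -, -, -, -, -, hL⟩ := this
  exact ⟨L, hL⟩

lemma gProjDimLE_of_isSyzygy {n : ℕ} {M X : ModuleCat.{u} R} (h : IsSyzygy n M X)
    (hX : IsGorensteinProjective R X) : GProjDimLE R n M := by
  induction n generalizing M with
  | zero =>
    obtain ⟨e⟩ := h
    obtain ⟨P, d, h₁, h₂, h₃, ⟨e'⟩⟩ := hX
    exact ⟨P, d, h₁, h₂, h₃, ⟨e.symm.trans e'⟩⟩
  | succ n ih =>
    obtain ⟨K, P, i, p, h, hP, hK⟩ := h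
    obtain ⟨e⟩ := h.equivKer
    exact Or.inr ⟨P, p, isGorensteinProjective_of_projective hP, h.surjective,
      ih (M := ModuleCat.of R (LinearMap.ker p)) (hK.of_equiv e)⟩

/-- The horseshoe lemma. -/
lemma exists_isSyzygy_ses {n : ℕ} {A B C X : ModuleCat.{u} R} {f : A →ₗ[R] B} {g : B →ₗ[R] C}
    (h : IsShortExact f g) (hX : IsSyzygy n A X) :
    ∃ (Y Z : ModuleCat.{u} R) (f' : X →ₗ[R] Y) (g' : Y →ₗ[R] Z),
      IsShortExact f' g' ∧ IsSyzygy n B Y ∧ IsSyzygy n C Z := by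
  induction n generalizing A B C with
  | zero =>
    obtain ⟨e⟩ := hX
    exact ⟨B, C, _, g, h.of_equiv_left e, ⟨LinearEquiv.refl R B⟩, ⟨LinearEquiv.refl R C⟩⟩
  | succ n ih =>
    obtain ⟨K, P, i, p, hK, hP, hKX⟩ := hX
    obtain ⟨Q, q, hQ, hq⟩ := exists_projective_cover C
    obtain ⟨l, hl⟩ := Module.projective_lifting_property g q h.surjective
    have hl' (x) : g (l x) = q x := LinearMap.congr_fun hl x
    let π : P × Q →ₗ[R] B := (f ∘ₗ p).coprod l
    have hπ (x : P × Q) : π x = f (p x.1) + l x.2 := LinearMap.coprod_apply _ _ _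
    have hπs : Function.Surjective π := fun b => by
      obtain ⟨y, hy⟩ := hq (g b)
      obtain ⟨a, ha⟩ := h.exists_eq (b := b - l y) (by rw [map_sub, hl', hy, sub_self])
      obtain ⟨x, rfl⟩ := hK.surjective a
      exact ⟨(x, y), by rw [hπ]; simp [ha]⟩
    have hπq (x : P × Q) (hx : π x = 0) : q x.2 = 0 := by
      have := congrArg g hx
      rwa [hπ, map_add, h.apply_apply, zero_add, hl', map_zero] at this
    let f' : K →ₗ[R] LinearMap.ker π := (LinearMap.inl R P Q ∘ₗ i).codRestrict _ fun x => by
      rw [LinearMap.mem_ker, hπ]; simp [hK.apply_apply]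
    let g' : LinearMap.ker π →ₗ[R] LinearMap.ker q :=
      (LinearMap.snd R P Q ∘ₗ (LinearMap.ker π).subtype).codRestrict _ fun x => hπq x.1 x.2
    have hses : IsShortExact (A := K) (B := ModuleCat.of R (LinearMap.ker π))
        (C := ModuleCat.of R (LinearMap.ker q)) f' g' := by
      refine ⟨fun x y hxy => hK.injective (congrArg (fun z => z.1.1) hxy), ?_, ?_⟩
      · rintro ⟨⟨x, y⟩, hxy⟩
        constructor
        · intro hy
          have hy : y = 0 := congrArg Subtype.val hy
          subst hy
          have hx : f (p x) = 0 := by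
            have : π (x, 0) = 0 := hxy
            simpa [hπ] using this
          obtain ⟨z, rfl⟩ := hK.exists_eq (h.injective (hx.trans (map_zero f).symm))
          exact ⟨z, rfl⟩
        · rintro ⟨z, hz⟩
          have : 0 = y := congrArg (fun z => z.1.2) hz
          exact Subtype.ext this.symm
      · rintro ⟨y, hy⟩
        obtain ⟨a, ha⟩ := h.exists_eq (b := -l y) (by rw [map_neg, hl', hy, neg_zero])
        obtain ⟨x, rfl⟩ := hK.surjective a
        exact ⟨⟨(x, y), by rw [LinearMap.mem_ker, hπ]; simp [ha]⟩, rfl⟩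
    obtain ⟨Y, Z, f'', g'', hs, hY, hZ⟩ := ih hses hKX
    exact ⟨Y, Z, f'', g'', hs,
      ⟨_, ModuleCat.of R (P × Q), _, π, IsShortExact.ofKer (B := ModuleCat.of R (P × Q)) π hπs,
        inferInstanceAs (Module.Projective R (P × Q)), hY⟩,
      ⟨_, Q, _, q, IsShortExact.ofKer q hq, hQ, hZ⟩⟩

open CategoryTheory in
lemma IsShortExact.shortExact {A B C : ModuleCat.{u} R} {f : A →ₗ[R] B} {g : B →ₗ[R] C}
    (h : IsShortExact f g) : (ShortComplex.mk (ModuleCat.ofHom f) (ModuleCat.ofHom g)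
      (by ext x; exact h.apply_apply x)).ShortExact where
  exact := by
    rw [ShortComplex.ShortExact.moduleCat_exact_iff_function_exact]
    exact h.exact
  mono_f := (ModuleCat.mono_iff_injective _).2 h.injective
  epi_g := (ModuleCat.epi_iff_surjective _).2 h.surjective

open CategoryTheory in
lemma hasProjectiveDimensionLE_of_projective {P : ModuleCat.{u} R} (hP : Module.Projective R P)
    (n : ℕ) : HasProjectiveDimensionLT P (n + 1) := by
  have : Projective P := (IsProjective.iff_projective (R := R) P).1 hP
  infer_instance

open CategoryTheory in
lemma ProjDimLE.hasProjectiveDimensionLE {n : ℕ} {M : ModuleCat.{u} R} (h : ProjDimLE R n M) :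
    HasProjectiveDimensionLT M (n + 1) := by
  induction n generalizing M with
  | zero => exact hasProjectiveDimensionLE_of_projective h 0
  | succ n ih =>
    obtain h | ⟨P, p, hP, hp, hK⟩ := h
    · exact hasProjectiveDimensionLE_of_projective h _
    · exact (IsShortExact.ofKer p hp).shortExact.hasProjectiveDimensionLT_X₃ (n + 1)
        (ih (M := ModuleCat.of R (LinearMap.ker p)) hK)
        (hasProjectiveDimensionLE_of_projective hP _)

open CategoryTheory in
lemma IsSyzygy.projective {n : ℕ} {M X : ModuleCat.{u} R} (h : IsSyzygy n M X)
    (hM : HasProjectiveDimensionLT M (n + 1)) : Module.Projective R X := by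
  induction n generalizing M with
  | zero =>
    obtain ⟨e⟩ := h
    have : Projective M := projective_iff_hasProjectiveDimensionLT_one.2 hM
    have : Module.Projective R M := (IsProjective.iff_projective (R := R) M).2 this
    exact Module.Projective.of_equiv e.symm
  | succ n ih =>
    obtain ⟨K, P, i, p, h, hP, hK⟩ := h
    exact ih hK (h.shortExact.hasProjectiveDimensionLT_X₁ (n + 1)
      (hasProjectiveDimensionLE_of_projective hP _) hM)

end Modules

section Hopf

open ModuleCat.Algebra

variable {k : Type u} [Field k] {H : Type u} [Ring H] [Algebra k H]

/-- The action of `H ⊗ H` on a tensor product of two `H`-modules. -/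
noncomputable def tensorAct (M N : ModuleCat.{u} H) :
    H ⊗[k] H →ₐ[k] Module.End k (M ⊗[k] N) :=
  (Module.endTensorEndAlgHom (R := k) (S := k) (A := k) (M := M) (N := N)).comp
    (Algebra.TensorProduct.map (Algebra.lsmul k k M) (Algebra.lsmul k k N))

@[simp]
lemma tensorAct_tmul (M N : ModuleCat.{u} H) (a b : H) (m : M) (n : N) :
    tensorAct M N (a ⊗ₜ[k] b) (m ⊗ₜ n) = (a • m) ⊗ₜ (b • n) := rfl

/-- The tensor product of two `H`-modules, with `H` acting through `D : H → H ⊗ H`. -/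
noncomputable def tens (D : H →ₐ[k] H ⊗[k] H) (M N : ModuleCat.{u} H) : ModuleCat.{u} H :=
  @ModuleCat.of H _ (M ⊗[k] N) _
    (Module.compHom (M ⊗[k] N) (((tensorAct M N).comp D).toRingHom : H →+* Module.End k (M ⊗[k] N)))

lemma tens_smul (D : H →ₐ[k] H ⊗[k] H) (M N : ModuleCat.{u} H) (h : H) (z : M ⊗[k] N) :
    (h • (show tens D M N from z)) = (show tens D M N from tensorAct M N (D h) z) := rfl

/-- An `H`-linear map out of a twisted tensor product is `k`-linear. -/
noncomputable def tensHom {D : H →ₐ[k] H ⊗[k] H} {M N W : ModuleCat.{u} H}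
    (F : tens D M N →ₗ[H] W) : M ⊗[k] N →ₗ[k] W where
  toFun z := F z
  map_add' x y := F.map_add x y
  map_smul' c z := by
    have h := F.map_smul (algebraMap k H c) z
    rw [algebraMap_smul] at h
    refine Eq.trans (congrArg F ?_) h
    refine Eq.trans ?_ (tens_smul D M N _ z).symm
    rw [AlgHom.commutes, AlgHom.commutes]
    rfl

/-- Construct an `H`-linear map out of a twisted tensor product. -/
noncomputable def tensLift {D : H →ₐ[k] H ⊗[k] H} {M N W : ModuleCat.{u} H}
    (F : M ⊗[k] N →ₗ[k] W) (hF : ∀ h z, F (tensorAct M N (D h) z) = h • F z) :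
    tens D M N →ₗ[H] W where
  toFun z := F z
  map_add' x y := F.map_add x y
  map_smul' h z := hF h z

/-- Construct an `H`-linear map between twisted tensor products. -/
noncomputable def tensMk {D D' : H →ₐ[k] H ⊗[k] H} {M N M' N' : ModuleCat.{u} H}
    (F : M ⊗[k] N →ₗ[k] M' ⊗[k] N')
    (hF : ∀ h z, F (tensorAct M N (D h) z) = tensorAct M' N' (D' h) (F z)) :
    tens D M N →ₗ[H] tens D' M' N' where
  toFun z := F z
  map_add' x y := F.map_add x y
  map_smul' h z := hF h z

lemma map_tensorAct {M N M' N' : ModuleCat.{u} H} (f : M →ₗ[H] M') (g : N →ₗ[H] N')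
    (t : H ⊗[k] H) (z : M ⊗[k] N) :
    TensorProduct.map (f.restrictScalars k) (g.restrictScalars k) (tensorAct M N t z) =
      tensorAct M' N' t (TensorProduct.map (f.restrictScalars k) (g.restrictScalars k) z) := by
  induction t with
  | zero => simp
  | add x y hx hy => simp [hx, hy]
  | tmul a b =>
    induction z with
    | zero => simp
    | add x y hx hy => simp only [map_add, hx, hy]
    | tmul m n => simp

/-- The tensor product of two `H`-linear maps. -/
noncomputable def tensMap (D : H →ₐ[k] H ⊗[k] H) {M N M' N' : ModuleCat.{u} H}
    (f : M →ₗ[H] M') (g : N →ₗ[H] N') : tens D M N →ₗ[H] tens D M' N' :=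
  tensMk (TensorProduct.map (f.restrictScalars k) (g.restrictScalars k))
    fun h z => map_tensorAct f g (D h) z

lemma IsShortExact.tensMap_right (D : H →ₐ[k] H ⊗[k] H) (M : ModuleCat.{u} H)
    {A B C : ModuleCat.{u} H} {f : A →ₗ[H] B} {g : B →ₗ[H] C} (h : IsShortExact f g) :
    IsShortExact (tensMap D (LinearMap.id : M →ₗ[H] M) f) (tensMap D LinearMap.id g) := by
  have he : Function.Exact (f.restrictScalars k) (g.restrictScalars k) := h.exact
  exact ⟨Module.Flat.lTensor_preserves_injective_linearMap (M := M) (f.restrictScalars k)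
    h.injective, lTensor_exact M he h.surjective,
    LinearMap.lTensor_surjective M (g := g.restrictScalars k) h.surjective⟩

lemma IsShortExact.tensMap_left (D : H →ₐ[k] H ⊗[k] H) (M : ModuleCat.{u} H)
    {A B C : ModuleCat.{u} H} {f : A →ₗ[H] B} {g : B →ₗ[H] C} (h : IsShortExact f g) :
    IsShortExact (tensMap D f (LinearMap.id : M →ₗ[H] M)) (tensMap D g LinearMap.id) := by
  have he : Function.Exact (f.restrictScalars k) (g.restrictScalars k) := h.exact
  exact ⟨Module.Flat.rTensor_preserves_injective_linearMap (M := M) (f.restrictScalars k)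
    h.injective, rTensor_exact M he h.surjective,
    LinearMap.rTensor_surjective M (g := g.restrictScalars k) h.surjective⟩

/-- `T` is an anti-endomorphism of `H` which behaves like an antipode for `D : H → H ⊗ H`. -/
structure IsTwist (D : H →ₐ[k] H ⊗[k] H) (T : H →ₗ[k] H) : Prop where
  map_one : T 1 = 1
  map_mul : ∀ a b, T (a * b) = T b * T a
  left : ∀ h, LinearMap.mul' k (H ⊗[k] H) (TensorProduct.map
    (LinearMap.lTensor H T ∘ₗ D.toLinearMap) (TensorProduct.mk k H H 1) (D h)) = h ⊗ₜ 1
  right : ∀ h, LinearMap.mul' k (H ⊗[k] H) (TensorProduct.map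
    D.toLinearMap (TensorProduct.mk k H H 1 ∘ₗ T) (D h)) = h ⊗ₜ 1

variable {D : H →ₐ[k] H ⊗[k] H} {T : H →ₗ[k] H}

/-- The action of `H ⊗ H` on `Hom(M, W)` by postcomposition and twisted precomposition. -/
noncomputable def homAct (hT : IsTwist D T) (M W : ModuleCat.{u} H) :
    H ⊗[k] H →ₐ[k] Module.End k (M →ₗ[k] W) :=
  Algebra.TensorProduct.lift
    (AlgHom.ofLinearMap
      { toFun := fun a => LinearMap.compRight k (Algebra.lsmul k k W a)
        map_add' := fun a b => by ext; simp
        map_smul' := fun c a => by ext; simp }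
      (by ext; simp) (fun a b => by ext; simp))
    (AlgHom.ofLinearMap
      { toFun := fun b => LinearMap.lcomp k W (Algebra.lsmul k k M (T b))
        map_add' := fun a b => by ext; simp
        map_smul' := fun c a => by ext; simp }
      (by ext; simp [hT.map_one]) (fun a b => by ext; simp [hT.map_mul]))
    (fun a b => by ext; simp)

@[simp]
lemma homAct_tmul (hT : IsTwist D T) (M W : ModuleCat.{u} H) (a b : H) (f : M →ₗ[k] W) (m : M) :
    homAct hT M W (a ⊗ₜ b) f m = a • f (T b • m) :=
  LinearMap.congr_fun (LinearMap.congr_fun (Algebra.TensorProduct.lift_tmul _ _ _ a b) f) m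

lemma comp_homAct (hT : IsTwist D T) {M W W' : ModuleCat.{u} H} (g : W →ₗ[H] W') (t : H ⊗[k] H)
    (f : M →ₗ[k] W) : (g.restrictScalars k) ∘ₗ homAct hT M W t f =
      homAct hT M W' t ((g.restrictScalars k) ∘ₗ f) := by
  ext m
  induction t with
  | zero => simp
  | add x y hx hy =>
    rw [map_add, map_add, LinearMap.add_apply, LinearMap.add_apply, LinearMap.comp_add,
      LinearMap.add_apply, LinearMap.add_apply, hx, hy]
  | tmul a b => simp

/-- The space `Hom(M, W)` with its twisted `H`-action. -/
noncomputable def ihom (hT : IsTwist D T) (M W : ModuleCat.{u} H) : ModuleCat.{u} H :=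
  @ModuleCat.of H _ (M →ₗ[k] W) _
    (Module.compHom (M →ₗ[k] W) (((homAct hT M W).comp D).toRingHom : H →+* Module.End k (M →ₗ[k] W)))

lemma ihom_smul (hT : IsTwist D T) (M W : ModuleCat.{u} H) (h : H) (f : M →ₗ[k] W) :
    (h • (show ihom hT M W from f)) = (show ihom hT M W from homAct hT M W (D h) f) := rfl

/-- The map `H ⊗ H → W`, `x ⊗ y ↦ x • f (y • m)`. -/
noncomputable def evalAct {M W : ModuleCat.{u} H} (f : M →ₗ[k] W) (m : M) : H ⊗[k] H →ₗ[k] W :=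
  TensorProduct.lift
    ((LinearMap.lcomp k W (f ∘ₗ (Algebra.lsmul k k M).toLinearMap.flip m)) ∘ₗ
      (Algebra.lsmul k k W).toLinearMap)

@[simp]
lemma evalAct_tmul {M W : ModuleCat.{u} H} (f : M →ₗ[k] W) (m : M) (x y : H) :
    evalAct f m (x ⊗ₜ[k] y) = x • f (y • m) := by
  simp [evalAct]

/-- Uncurrying for the twisted internal hom. -/
lemma exists_uncurry (hT : IsTwist D T) {P M W : ModuleCat.{u} H} (s : P →ₗ[H] ihom hT M W) :
    ∃ b : tens D P M →ₗ[H] W, ∀ p m, b (p ⊗ₜ[k] m) = (show M →ₗ[k] W from s p) m := by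
  let s' : P →ₗ[k] M →ₗ[k] W :=
    { toFun := fun p => s p
      map_add' := fun x y => s.map_add x y
      map_smul' := fun c p => by
        have h := s.map_smul (algebraMap k H c) p
        rw [algebraMap_smul] at h
        refine h.trans ((ihom_smul hT M W _ _).trans ?_)
        rw [AlgHom.commutes, AlgHom.commutes]
        rfl }
  have hs (h : H) (p : P) : s' (h • p) = homAct hT M W (D h) (s' p) := s.map_smul h p
  refine ⟨tensLift (TensorProduct.lift s') fun h z => ?_, fun p m => TensorProduct.lift.tmul p m⟩
  induction z with
  | zero => simp
  | add x y hx hy => simp only [map_add, hx, hy, smul_add]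
  | tmul p m =>
    have h1 (t : H ⊗[k] H) (c : H) : homAct hT M W t (s' p) (c • m) =
        evalAct (s' p) m (LinearMap.lTensor H T t * (1 ⊗ₜ c)) := by
      induction t with
      | zero => simp
      | add x y hx hy => simp only [map_add, add_mul, LinearMap.add_apply, hx, hy]
      | tmul a b => simp [mul_smul]
    have h2 (t : H ⊗[k] H) : TensorProduct.lift s' (tensorAct P M t (p ⊗ₜ m)) =
        evalAct (s' p) m (LinearMap.mul' k (H ⊗[k] H) (TensorProduct.map
          (LinearMap.lTensor H T ∘ₗ D.toLinearMap) (TensorProduct.mk k H H 1) t)) := by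
      induction t with
      | zero => simp
      | add x y hx hy => simp only [map_add, LinearMap.add_apply, hx, hy]
      | tmul a b => simp [hs, h1]
    rw [h2, hT.left]
    simp

/-- Currying for the twisted internal hom. -/
lemma exists_curry (hT : IsTwist D T) {P M W : ModuleCat.{u} H} (F : tens D P M →ₗ[H] W) :
    ∃ s : P →ₗ[H] ihom hT M W, ∀ p m, (show M →ₗ[k] W from s p) m = F (p ⊗ₜ[k] m) := by
  let φ : P →ₗ[k] M →ₗ[k] W := TensorProduct.curry (tensHom F)
  have hF (t : H) (z : P ⊗[k] M) : tensHom F (tensorAct P M (D t) z) = t • tensHom F z :=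
    F.map_smul t z
  refine ⟨⟨⟨fun p => φ p, fun x y => φ.map_add x y⟩, fun h p => ?_⟩, fun p m => rfl⟩
  change φ (h • p) = homAct hT M W (D h) (φ p)
  ext m
  have h2 (t : H ⊗[k] H) : homAct hT M W t (φ p) m = tensHom F (tensorAct P M
      (LinearMap.mul' k (H ⊗[k] H) (TensorProduct.map
        D.toLinearMap (TensorProduct.mk k H H 1 ∘ₗ T) t)) (p ⊗ₜ m)) := by
    induction t with
    | zero => simp
    | add x y hx hy => simp only [map_add, LinearMap.add_apply, hx, hy]
    | tmul a b => simp [hF, φ]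
  rw [h2, hT.right]
  simp [φ]

/-- Tensoring a projective module with any module gives a projective module. -/
lemma tens_projective (hT : IsTwist D T) {P : ModuleCat.{u} H} (hP : Module.Projective H P)
    (M : ModuleCat.{u} H) : Module.Projective H (tens D P M) := by
  obtain ⟨W, g, hW, hg⟩ := exists_projective_cover (tens D P M)
  obtain ⟨φ, hφ⟩ := exists_curry hT (LinearMap.id : tens D P M →ₗ[H] tens D P M)
  let G : ihom hT M W →ₗ[H] ihom hT M (tens D P M) :=
    { toFun := fun f => (g.restrictScalars k) ∘ₗ (show M →ₗ[k] W from f)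
      map_add' := fun x y => LinearMap.comp_add _ _ _
      map_smul' := fun h f => comp_homAct hT g (D h) f }
  have hG : Function.Surjective G := fun f => by
    obtain ⟨r, hr⟩ := (g.restrictScalars k).exists_rightInverse_of_surjective
      (LinearMap.range_eq_top.2 hg)
    refine ⟨r ∘ₗ (show M →ₗ[k] tens D P M from f), ?_⟩
    change (g.restrictScalars k) ∘ₗ r ∘ₗ (show M →ₗ[k] tens D P M from f) = f
    rw [← LinearMap.comp_assoc, hr]
    rfl
  obtain ⟨s, hs⟩ := Module.projective_lifting_property G φ hG
  obtain ⟨b, hb⟩ := exists_uncurry hT s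
  refine Module.Projective.of_split b g (LinearMap.ext fun z => ?_)
  have key (z : P ⊗[k] M) : g (b z) = z := by
    induction z with
    | zero => exact (congrArg g b.map_zero).trans g.map_zero
    | add x y hx hy =>
      refine (congrArg g (b.map_add x y)).trans ((g.map_add _ _).trans ?_)
      rw [hx, hy]
      rfl
    | tmul p m =>
      rw [hb]
      have := congrArg (fun f : ihom hT M (tens D P M) => (show M →ₗ[k] tens D P M from f) m)
        (LinearMap.congr_fun hs p)
      exact this.trans (hφ p m)
  exact key z

lemma exists_retraction (hT : IsTwist D T) {ε : H →ₗ[k] k}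
    (hε : ∀ h, TensorProduct.rid k H (ε.lTensor H (D h)) = h)
    {Q Λ : ModuleCat.{u} H} (hQ : Module.Projective H Q) {e : Λ} (he : e ≠ 0)
    (hTe : ∀ b, T b • e = ε b • e) :
    ∃ ρ : tens D Q Λ →ₗ[H] Q, ∀ q : Q, ρ (q ⊗ₜ[k] e) = q := by
  have hact (t : H ⊗[k] H) (f : Λ →ₗ[k] Q) :
      homAct hT Λ Q t f e = TensorProduct.rid k H (ε.lTensor H t) • f e := by
    induction t with
    | zero => simp
    | add x y hx hy => simp only [map_add, LinearMap.add_apply, add_smul, hx, hy]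
    | tmul a b =>
      rw [homAct_tmul, hTe, map_smul, LinearMap.lTensor_tmul, TensorProduct.rid_tmul, smul_comm,
        smul_assoc]
  let E : ihom hT Λ Q →ₗ[H] Q :=
    { toFun := fun f => (show Λ →ₗ[k] Q from f) e
      map_add' := fun x y => rfl
      map_smul' := fun h f => (hact (D h) f).trans (by rw [hε]; rfl) }
  have hE : Function.Surjective E := fun q => by
    obtain ⟨φ, hφ⟩ := Module.Projective.exists_dual_eq_one k he
    exact ⟨φ.smulRight q, (congrArg (· • q) hφ).trans (one_smul k q)⟩
  obtain ⟨s, hs⟩ := Module.projective_lifting_property E LinearMap.id hE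
  obtain ⟨b, hb⟩ := exists_uncurry hT s
  exact ⟨b, fun q => (hb q e).trans (LinearMap.congr_fun hs q)⟩

lemma IsTwist.of_coassoc {ε : H →ₗ[k] k} (h_one : T 1 = 1) (h_mul : ∀ a b, T (a * b) = T b * T a)
    (h_assoc : ∀ h, TensorProduct.assoc k H H H (D.toLinearMap.rTensor H (D h)) =
      D.toLinearMap.lTensor H (D h))
    (h_counit : ∀ h, ε.lTensor H (D h) = h ⊗ₜ 1)
    (h_left : ∀ h, LinearMap.mul' k H (T.rTensor H (D h)) = algebraMap k H (ε h))
    (h_right : ∀ h, LinearMap.mul' k H (T.lTensor H (D h)) = algebraMap k H (ε h)) :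
    IsTwist D T := by
  have key (F : H ⊗[k] H →ₗ[k] H) (hF : ∀ h, F (D h) = algebraMap k H (ε h)) (h : H) :
      F.lTensor H (TensorProduct.assoc k H H H (D.toLinearMap.rTensor H (D h))) = h ⊗ₜ 1 := by
    have h1 : F ∘ₗ D.toLinearMap = Algebra.linearMap k H ∘ₗ ε := LinearMap.ext hF
    rw [h_assoc, ← LinearMap.comp_apply, ← LinearMap.lTensor_comp, h1, LinearMap.lTensor_comp,
      LinearMap.comp_apply, h_counit]
    simp
  refine ⟨h_one, h_mul, fun h => ?_, fun h => ?_⟩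
  · rw [← key (LinearMap.mul' k H ∘ₗ T.rTensor H) h_left h]
    generalize D h = t
    induction t with
    | zero => simp
    | add x y hx hy => simp only [map_add, hx, hy]
    | tmul a b =>
      simp only [TensorProduct.map_tmul, LinearMap.comp_apply, LinearMap.rTensor_tmul,
        LinearMap.mul'_apply, TensorProduct.mk_apply]
      generalize D.toLinearMap a = s
      induction s with
      | zero => simp
      | add x y hx hy => simp only [map_add, add_mul, TensorProduct.add_tmul, hx, hy]
      | tmul x y => simp
  · rw [← key (LinearMap.mul' k H ∘ₗ T.lTensor H) h_right h]
    generalize D h = t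
    induction t with
    | zero => simp
    | add x y hx hy => simp only [map_add, hx, hy]
    | tmul a b =>
      simp only [TensorProduct.map_tmul, LinearMap.comp_apply, LinearMap.rTensor_tmul,
        LinearMap.mul'_apply, TensorProduct.mk_apply]
      generalize D.toLinearMap a = s
      induction s with
      | zero => simp
      | add x y hx hy => simp only [map_add, add_mul, TensorProduct.add_tmul, hx, hy]
      | tmul x y => simp

/-- The opposite of a comultiplication. -/
noncomputable def swapped (D : H →ₐ[k] H ⊗[k] H) : H →ₐ[k] H ⊗[k] H :=
  (Algebra.TensorProduct.comm k H H).toAlgHom.comp D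

lemma swapped_apply (D : H →ₐ[k] H ⊗[k] H) (h : H) :
    swapped D h = TensorProduct.comm k H H (D h) := rfl

lemma swapped_assoc
    (h_assoc : ∀ h, TensorProduct.assoc k H H H (D.toLinearMap.rTensor H (D h)) =
      D.toLinearMap.lTensor H (D h)) (h : H) :
    TensorProduct.assoc k H H H ((swapped D).toLinearMap.rTensor H (swapped D h)) =
      (swapped D).toLinearMap.lTensor H (swapped D h) := by
  let ρ : H ⊗[k] (H ⊗[k] H) →ₗ[k] H ⊗[k] (H ⊗[k] H) :=
    (TensorProduct.assoc k H H H).toLinearMap ∘ₗ (TensorProduct.comm k H (H ⊗[k] H)).toLinearMap ∘ₗ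
      (TensorProduct.comm k H H).toLinearMap.lTensor H
  have h1 (t : H ⊗[k] H) : TensorProduct.assoc k H H H ((swapped D).toLinearMap.rTensor H
      (TensorProduct.comm k H H t)) = ρ (D.toLinearMap.lTensor H t) := by
    induction t with
    | zero => simp
    | add x y hx hy => simp only [map_add, hx, hy]
    | tmul a b => simp [ρ, swapped_apply]
  have h2 (t : H ⊗[k] H) : ρ (TensorProduct.assoc k H H H (D.toLinearMap.rTensor H t)) =
      (swapped D).toLinearMap.lTensor H (TensorProduct.comm k H H t) := by
    induction t with
    | zero => simp
    | add x y hx hy => simp only [map_add, hx, hy]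
    | tmul a b =>
      simp only [LinearMap.rTensor_tmul, TensorProduct.comm_tmul, LinearMap.lTensor_tmul,
        AlgHom.toLinearMap_apply, swapped_apply]
      generalize D a = s
      induction s with
      | zero => simp
      | add x y hx hy => simp only [map_add, TensorProduct.add_tmul, TensorProduct.tmul_add, hx, hy]
      | tmul x y => simp [ρ]
  rw [swapped_apply, h1, ← h_assoc, h2]

lemma comm_tensorAct (M N : ModuleCat.{u} H) (t : H ⊗[k] H) (z : M ⊗[k] N) :
    TensorProduct.comm k M N (tensorAct M N t z) =
      tensorAct N M (TensorProduct.comm k H H t) (TensorProduct.comm k M N z) := by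
  induction t with
  | zero => simp
  | add x y hx hy => simp only [map_add, LinearMap.add_apply, hx, hy]
  | tmul a b =>
    induction z with
    | zero => simp
    | add x y hx hy => simp only [map_add, hx, hy]
    | tmul m n => simp

lemma swapped_tens_projective (hT : IsTwist (swapped D) T) {P : ModuleCat.{u} H}
    (hP : Module.Projective H P) (M : ModuleCat.{u} H) : Module.Projective H (tens D M P) := by
  have := tens_projective hT hP M
  let f : tens (swapped D) P M →ₗ[H] tens D M P :=
    tensMk (TensorProduct.comm k P M).toLinearMap fun h z => by
      refine (comm_tensorAct P M _ z).trans ?_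
      rw [swapped_apply, TensorProduct.comm_comm]
      rfl
  exact Module.Projective.of_equiv
    (LinearEquiv.ofBijective f (TensorProduct.comm k P M).bijective)

lemma ProjDimLE.tens {M : ModuleCat.{u} H}
    (hD : ∀ P : ModuleCat.{u} H, Module.Projective H P → Module.Projective H (tens D M P))
    {n : ℕ} {Λ : ModuleCat.{u} H} (h : ProjDimLE H n Λ) : ProjDimLE H n (tens D M Λ) := by
  induction n generalizing Λ with
  | zero => exact hD Λ h
  | succ n ih =>
    obtain h | ⟨P, f, hP, hf, hK⟩ := h
    · exact Or.inl (hD Λ h)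
    · exact .of_ses ((IsShortExact.ofKer f hf).tensMap_right D M) (hD P hP) (ih hK)

lemma IsSyzygy.tens (hT : IsTwist D T) (Λ : ModuleCat.{u} H) {n : ℕ} {M X : ModuleCat.{u} H}
    (h : IsSyzygy n M X) : IsSyzygy n (tens D M Λ) (tens D X Λ) := by
  induction n generalizing M with
  | zero =>
    obtain ⟨e⟩ := h
    exact ⟨LinearEquiv.ofBijective (tensMap D e.toLinearMap (LinearMap.id : Λ →ₗ[H] Λ))
      ((e.restrictScalars k).rTensor Λ).bijective⟩
  | succ n ih =>
    obtain ⟨K, P, i, p, hip, hP, hK⟩ := h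
    exact ⟨_, _, _, _, hip.tensMap_left D Λ, tens_projective hT hP Λ, ih hK⟩

/-- The embedding `m ↦ m ⊗ e` for an element `e` on which `H` acts trivially. -/
noncomputable def tensUnit {ε : H →ₗ[k] k}
    (hε : ∀ h, TensorProduct.rid k H (ε.lTensor H (D h)) = h) {Λ : ModuleCat.{u} H} {e : Λ}
    (he : ∀ b : H, b • e = ε b • e) (M : ModuleCat.{u} H) : M →ₗ[H] tens D M Λ where
  toFun m := m ⊗ₜ[k] e
  map_add' x y := TensorProduct.add_tmul x y e
  map_smul' h m := by
    have key (t : H ⊗[k] H) : tensorAct M Λ t (m ⊗ₜ[k] e) =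
        (TensorProduct.rid k H (ε.lTensor H t) • m) ⊗ₜ e := by
      induction t with
      | zero => simp
      | add x y hx hy =>
        simp only [map_add, LinearMap.add_apply, add_smul, TensorProduct.add_tmul, hx, hy]
      | tmul a b => simp [he, TensorProduct.smul_tmul]
    exact (congrArg (fun a => (a • m) ⊗ₜ[k] e) (hε h)).symm.trans (key (D h)).symm

lemma tensUnit_injective {ε : H →ₗ[k] k}
    (hε : ∀ h, TensorProduct.rid k H (ε.lTensor H (D h)) = h) {Λ : ModuleCat.{u} H} {e : Λ}
    (he : ∀ b : H, b • e = ε b • e) (he0 : e ≠ 0) (M : ModuleCat.{u} H) :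
    Function.Injective (tensUnit hε he M) := by
  obtain ⟨φ, hφ⟩ := Module.Projective.exists_dual_eq_one k he0
  refine Function.LeftInverse.injective
    (g := fun z : M ⊗[k] Λ => TensorProduct.rid k M (φ.lTensor M z)) fun m => ?_
  change TensorProduct.rid k M (φ.lTensor M (m ⊗ₜ e)) = m
  simp [hφ]

lemma extOneProjVanish_of_tens (hT : IsTwist D T) {ε : H →ₗ[k] k}
    (hε : ∀ h, TensorProduct.rid k H (ε.lTensor H (D h)) = h) {Λ : ModuleCat.{u} H} {e : Λ}
    (he : ∀ b : H, b • e = ε b • e) (he0 : e ≠ 0) (hεT : ∀ b, ε (T b) = ε b)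
    {X : ModuleCat.{u} H} (hX : Module.Projective H (tens D X Λ)) : ExtOneProjVanish X := by
  intro Q A Y hQ i p h f
  obtain ⟨ρ, hρ⟩ := exists_retraction hT hε hQ he0 fun b => by rw [he, hεT]
  obtain ⟨g, hg⟩ := extOneProjVanish_of_projective hX _ _ _ (tens_projective hT hQ Λ) _ _
    (h.tensMap_left D Λ) (tensMap D f LinearMap.id)
  exact ⟨ρ ∘ₗ g ∘ₗ tensUnit hε he Y, fun a => (congrArg ρ (hg (a ⊗ₜ[k] e))).trans (hρ (f a))⟩

/-- A module of finite projective dimension containing the trivial module bounds all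
Gorenstein projective dimensions. -/
lemma gProjDimLE_of_trivial_sub (hT : IsTwist D T)
    (hD : ∀ M P : ModuleCat.{u} H, Module.Projective H P → Module.Projective H (tens D M P))
    {ε : H →ₗ[k] k} (hε : ∀ h, TensorProduct.rid k H (ε.lTensor H (D h)) = h)
    {Λ : ModuleCat.{u} H} {e : Λ} (he : ∀ b : H, b • e = ε b • e) (he0 : e ≠ 0)
    (hεT : ∀ b, ε (T b) = ε b) {n : ℕ} (hΛ : ProjDimLE H n Λ) (M : ModuleCat.{u} H) :
    GProjDimLE H n M := by
  have htens (M) : CategoryTheory.HasProjectiveDimensionLT (tens D M Λ) (n + 1) :=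
    (hΛ.tens (hD M)).hasProjectiveDimensionLE
  obtain ⟨X, hX⟩ := exists_isSyzygy n M
  refine gProjDimLE_of_isSyzygy hX (isGorensteinProjective_of_class
    (fun X => ∃ M, IsSyzygy n M X) ?_ ?_ ?_ ⟨M, hX⟩)
  · rintro X ⟨M, hX⟩
    exact extOneProjVanish_of_tens hT hε he he0 hεT ((hX.tens hT Λ).projective (htens M))
  · rintro X ⟨M, hX⟩
    obtain ⟨Y, Z, i, p, hip, hY, hZ⟩ :=
      exists_isSyzygy_ses (.ofRange _ (tensUnit_injective hε he he0 M)) hX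
    exact ⟨Y, Z, i, p, hip, hY.projective (htens M), _, hZ⟩
  · rintro X ⟨M, hX⟩
    obtain ⟨P, p, hP, hp⟩ := exists_projective_cover X
    exact ⟨_, P, _, p, .ofKer p hp, hP, hX.exists_of_ses (.ofKer p hp) hP⟩

end Hopf

section HopfAlgebra

variable (k : Type u) [Field k] (H : Type u) [Ring H] [HopfAlgebra k H]

lemma isTwist_antipode :
    IsTwist (Bialgebra.comulAlgHom k H) (HopfAlgebra.antipode k (A := H)) :=
  .of_coassoc (ε := Coalgebra.counit) HopfAlgebra.antipode_one HopfAlgebra.antipode_mul_antidistrib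
    Coalgebra.coassoc_apply Coalgebra.lTensor_counit_comul
    HopfAlgebra.mul_antipode_rTensor_comul_apply HopfAlgebra.mul_antipode_lTensor_comul_apply

lemma antipode_algebraMap (c : k) :
    HopfAlgebra.antipode k (algebraMap k H c) = algebraMap k H c := by
  rw [Algebra.algebraMap_eq_smul_one, map_smul, HopfAlgebra.antipode_one]

variable {k H}

lemma isTwist_swapped (hS : Function.Bijective (HopfAlgebra.antipode (R := k) (A := H))) :
    IsTwist (swapped (Bialgebra.comulAlgHom k H))
      (LinearEquiv.ofBijective (HopfAlgebra.antipode k (A := H)) hS).symm.toLinearMap := by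
  let S := LinearEquiv.ofBijective (HopfAlgebra.antipode k (A := H)) hS
  have hST (a : H) : HopfAlgebra.antipode k (S.symm a) = a := S.apply_symm_apply a
  refine .of_coassoc (ε := Coalgebra.counit) (hS.1 ?_) (fun a b => hS.1 ?_)
    (swapped_assoc Coalgebra.coassoc_apply) (fun h => ?_) (fun h => hS.1 ?_) (fun h => hS.1 ?_)
  · exact (hST 1).trans HopfAlgebra.antipode_one.symm
  · refine (hST _).trans ((HopfAlgebra.antipode_mul_antidistrib _ _).trans ?_).symm
    exact congrArg₂ (· * ·) (hST a) (hST b)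
  · have key (t : H ⊗[k] H) :
        (Coalgebra.counit (R := k)).lTensor H (TensorProduct.comm k H H t) =
          TensorProduct.comm k k H ((Coalgebra.counit (R := k)).rTensor H t) := by
      induction t with
      | zero => simp
      | add x y hx hy => simp only [map_add, hx, hy]
      | tmul a b => simp
    exact (key _).trans ((congrArg _ (Coalgebra.rTensor_counit_comul h)).trans
      (TensorProduct.comm_tmul k k H 1 h))
  · have key (t : H ⊗[k] H) : HopfAlgebra.antipode k (LinearMap.mul' k H
        (S.symm.toLinearMap.rTensor H (TensorProduct.comm k H H t))) =
          LinearMap.mul' k H ((HopfAlgebra.antipode k).rTensor H t) := by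
      induction t with
      | zero => simp
      | add x y hx hy => simp only [map_add, hx, hy]
      | tmul a b => simp [HopfAlgebra.antipode_mul_antidistrib, hST]
    refine (key _).trans ?_
    rw [antipode_algebraMap]
    exact HopfAlgebra.mul_antipode_rTensor_comul_apply h
  · have key (t : H ⊗[k] H) : HopfAlgebra.antipode k (LinearMap.mul' k H
        (S.symm.toLinearMap.lTensor H (TensorProduct.comm k H H t))) =
          LinearMap.mul' k H ((HopfAlgebra.antipode k).lTensor H t) := by
      induction t with
      | zero => simp
      | add x y hx hy => simp only [map_add, hx, hy]
      | tmul a b => simp [HopfAlgebra.antipode_mul_antidistrib, hST]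
    refine (key _).trans ?_
    rw [antipode_algebraMap]
    exact HopfAlgebra.mul_antipode_lTensor_comul_apply h

open ModuleCat.Algebra in
lemma gProjDimLE_of_trivMod_embeds
    (hS : Function.Bijective (HopfAlgebra.antipode (R := k) (A := H))) {Λ : ModuleCat.{u} H}
    (ι : trivMod k H →ₗ[H] Λ) (hι : Function.Injective ι) {n : ℕ} (hΛ : ProjDimLE H n Λ)
    (M : ModuleCat.{u} H) : GProjDimLE H n M := by
  let x : trivMod k H := (1 : k)
  have hx : x ≠ 0 := one_ne_zero (α := k)
  have hact (b : H) : b • x = algebraMap k H (Coalgebra.counit b) • x := by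
    change (Coalgebra.counit b : k) * 1 =
      (Coalgebra.counit (algebraMap k H (Coalgebra.counit b)) : k) * 1
    rw [Bialgebra.counit_algebraMap]
  refine gProjDimLE_of_trivial_sub (isTwist_antipode k H)
    (fun M P hP => swapped_tens_projective (isTwist_swapped hS) hP M)
    (ε := Coalgebra.counit) (fun h => ?_) (e := ι x) (fun b => ?_)
    (fun h => hx (hι (h.trans ι.map_zero.symm))) HopfAlgebra.counit_antipode hΛ M
  · rw [Bialgebra.comulAlgHom_apply, Coalgebra.lTensor_counit_comul, TensorProduct.rid_tmul,
      one_smul]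
  · rw [← ι.map_smul, hact, ι.map_smul]
    exact algebraMap_smul H _ _

end HopfAlgebra

section Dimension

variable {R : Type u} [Ring R] {M : Type u} [AddCommGroup M] [Module R M] {n : ℕ}

lemma gProjDim_le (h : GProjDimLE R n M) : gProjDim R M ≤ n := sInf_le ⟨n, rfl, h⟩

lemma projDim_le (h : ProjDimLE R n M) : projDim R M ≤ n := sInf_le ⟨n, rfl, h⟩

lemma exists_gProjDimLE (h : gProjDim R M < ⊤) :
    ∃ n : ℕ, gProjDim R M = n ∧ GProjDimLE R n M := by
  obtain ⟨a, ha, -⟩ := sInf_lt_iff.1 h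
  exact csInf_mem ⟨a, ha⟩

lemma exists_projDimLE (h : projDim R M < ⊤) : ∃ n : ℕ, projDim R M = n ∧ ProjDimLE R n M := by
  obtain ⟨a, ha, -⟩ := sInf_lt_iff.1 h
  exact csInf_mem ⟨a, ha⟩

end Dimension

lemma gProjDim_le_projDim {k : Type u} [Field k] {H : Type u} [Ring H] [HopfAlgebra k H]
    (hS : Function.Bijective (HopfAlgebra.antipode (R := k) (A := H))) {Λ : ModuleCat.{u} H}
    (ι : trivMod k H →ₗ[H] Λ) (hι : Function.Injective ι) (M : ModuleCat.{u} H) :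
    gProjDim H M ≤ projDim H Λ := by
  obtain h | h := eq_or_ne (projDim H Λ) ⊤
  · exact h ▸ le_top
  · obtain ⟨n, hn, hΛ⟩ := exists_projDimLE h.lt_top
    exact hn ▸ gProjDim_le (gProjDimLE_of_trivMod_embeds hS ι hι hΛ M)

lemma exists_embedding_projDim_le {R : Type u} [Ring R] {M : ModuleCat.{u} R}
    (hM : gProjDim R M < ⊤) : ∃ (Λ : ModuleCat.{u} R) (ι : M →ₗ[R] Λ),
      Function.Injective ι ∧ projDim R Λ ≤ gProjDim R M := by
  obtain ⟨n, hn, h⟩ := exists_gProjDimLE hM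
  obtain ⟨Λ, _, ι, _, hι, hΛ, _⟩ := embedsWith_of_gProjDimLE h
  exact ⟨Λ, ι, hι.injective, hn ▸ projDim_le hΛ⟩

/-- Let `H` be a Hopf algebra over a field `k` with bijective antipode.
The following are equivalent: (1) `Gpd_H(εk) < ∞`; (2) there is a monomorphism of left
`H`-modules `ι : εk → Λ` with `pd_H(Λ) < ∞`; (3) `Gpd_H(M) < ∞` for every left `H`-module `M`.
Moreover `l.Ggldim(H) = Gpd_H(εk)`, and in the finite case a monomorphism `ι : εk → Λ` with
`pd_H(Λ) = Gpd_H(εk)` exists. -/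
theorem gProjDim_trivial_test_module (k : Type u) [Field k]
    (H : Type u) [Ring H] [HopfAlgebra k H]
    (hS : Function.Bijective (HopfAlgebra.antipode (R := k) (A := H))) :
    (gProjDim H (trivMod k H) < ⊤ ↔
      ∃ (Λ : ModuleCat.{u} H) (ι : trivMod k H →ₗ[H] Λ),
        Function.Injective ι ∧ projDim H Λ < ⊤) ∧
    (gProjDim H (trivMod k H) < ⊤ ↔ ∀ M : ModuleCat.{u} H, gProjDim H M < ⊤) ∧
    lGgldim H = gProjDim H (trivMod k H) ∧
    (gProjDim H (trivMod k H) < ⊤ →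
      ∃ (Λ : ModuleCat.{u} H) (ι : trivMod k H →ₗ[H] Λ),
        Function.Injective ι ∧ projDim H Λ = gProjDim H (trivMod k H)) := by
 
  have key (h : gProjDim H (trivMod k H) < ⊤) := exists_embedding_projDim_le h
  have bound (h : gProjDim H (trivMod k H) < ⊤) (M : ModuleCat.{u} H) :
      gProjDim H M ≤ gProjDim H (trivMod k H) := by
    obtain ⟨Λ, ι, hι, hΛ⟩ := key h
    exact (gProjDim_le_projDim hS ι hι M).trans hΛ
  refine ⟨⟨fun h => ?_, ?_⟩, ⟨fun h M => (bound h M).trans_lt h, fun h => h _⟩, le_antisymm ?_ ?_,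
    fun h => ?_⟩
  · obtain ⟨Λ, ι, hι, hΛ⟩ := key h
    exact ⟨Λ, ι, hι, hΛ.trans_lt h⟩
  · rintro ⟨Λ, ι, hι, hΛ⟩
    exact (gProjDim_le_projDim hS ι hι _).trans_lt hΛ
  · obtain h | h := eq_or_ne (gProjDim H (trivMod k H)) ⊤
    · exact h ▸ le_top
    · exact iSup_le fun M => bound h.lt_top M
  · exact le_iSup (fun M : ModuleCat.{u} H => gProjDim H M) (trivMod k H)
  · obtain ⟨Λ, ι, hι, hΛ⟩ := key h
    exact ⟨Λ, ι, hι, hΛ.antisymm (gProjDim_le_projDim hS ι hι _)⟩
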